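/- arXiv:2601.18167 — 2 statements merged into one kernel-verified Lean document; each statement's English description precedes it below -/
import Mathlib

section
/- Let n ≥ 3 be an integer and let t > 1 be a real number. Then ((t^n − 1)^(2n) − n^2·t^(n−1)·(t − 1)^2·(t^n − 1)^(2n−2)) / ((t^(2n) − n·t^(n+1) + n·t^(n−1) − 1)^n) ≥ 1. -/
/-- The inequality `m * sinh x ≤ sinh (m * x)` for `m = k + 1`, in the variable `r = exp (-x)`. -/
lemma succ_mul_pow_mul_one_sub_sq_le (k : ℕ) {r : ℝ} (h0 : 0 ≤ r) (h1 : r ≤ 1) :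
    ((k : ℝ) + 1) * r ^ k * (1 - r ^ 2) ≤ 1 - r ^ (2 * k + 2) := by
  induction k with
  | zero => simp
  | succ k ih =>
    have hr : 0 ≤ 1 - r ^ 2 := by nlinarith
    have hk : 0 ≤ ((k : ℝ) + 1) * r ^ k * (1 - r ^ 2) := by positivity
    have e : r ^ (2 * k + 2) = (r ^ k * r) ^ 2 := by ring
    have e' : r ^ (2 * (k + 1) + 2) = (r ^ k * r) ^ 2 * r ^ 2 := by ring
    rw [e', pow_succ]
    rw [e] at ih
    push_cast
    nlinarith [mul_le_mul_of_nonneg_right ih (by positivity : 0 ≤ 1 + r ^ 2),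
      mul_nonneg hk (sq_nonneg (1 - r)), mul_nonneg hr (sq_nonneg (1 - r ^ k * r))]

lemma succ_mul_pow_mul_one_sub_sq_lt (k : ℕ) {r : ℝ} (h0 : 0 ≤ r) (h1 : r < 1) :
    ((k : ℝ) + 2) * r ^ (k + 1) * (1 - r ^ 2) < 1 - r ^ (2 * k + 4) := by
  have hr : 0 < 1 - r ^ 2 := by nlinarith
  have hk : 0 ≤ ((k : ℝ) + 1) * r ^ k * (1 - r ^ 2) := by positivity
  have hp : r ^ k * r < 1 := by
    rw [← pow_succ]; exact pow_lt_one₀ h0 h1 (by simp)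
  have ih := succ_mul_pow_mul_one_sub_sq_le k h0 h1.le
  have e : r ^ (2 * k + 2) = (r ^ k * r) ^ 2 := by ring
  have e' : r ^ (2 * k + 4) = (r ^ k * r) ^ 2 * r ^ 2 := by ring
  rw [e', pow_succ]
  rw [e] at ih
  nlinarith [mul_le_mul_of_nonneg_right ih (by positivity : 0 ≤ 1 + r ^ 2),
    mul_nonneg hk (sq_nonneg (1 - r)), mul_pos hr (sq_pos_of_pos (sub_pos.2 hp))]

/-- The inequality `m * sinh x * cosh x ≤ sinh (m * x)` for `m = k + 2`, in the variable
`r = exp (-x)`. -/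
lemma mul_pow_mul_one_sub_sq_mul_one_add_sq_le (k : ℕ) {r : ℝ} (h0 : 0 ≤ r) (h1 : r ≤ 1) :
    ((k : ℝ) + 2) * r ^ k * (1 - r ^ 2) * (1 + r ^ 2) ≤ 2 * (1 - r ^ (2 * k + 4)) := by
  have hr : 0 ≤ 1 - r ^ 2 := by nlinarith
  have hk : r ^ k ≤ 1 := pow_le_one₀ h0 h1
  have hk' : r ^ k * r ^ 2 ≤ 1 := by rw [← pow_add]; exact pow_le_one₀ h0 h1
  have ih := succ_mul_pow_mul_one_sub_sq_le k h0 h1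
  have e : r ^ (2 * k + 2) = (r ^ k * r) ^ 2 := by ring
  have e' : r ^ (2 * k + 4) = (r ^ k * r) ^ 2 * r ^ 2 := by ring
  rw [e']
  rw [e] at ih
  nlinarith [mul_le_mul_of_nonneg_right ih (by positivity : 0 ≤ 1 + r ^ 2),
    mul_nonneg hr (mul_nonneg (sub_nonneg.2 hk) (sub_nonneg.2 hk'))]

/-- The inequality `m * (m - 1) * sinh x ^ 2 * cosh x ≤ sinh (m * x) * sinh ((m - 1) * x)` for
`m = k + 2`, in the variable `s = exp (-2 * x)`. -/
lemma mul_pow_mul_one_sub_sq_mul_one_add_le (k : ℕ) {s : ℝ} (h0 : 0 ≤ s) (h1 : s ≤ 1) :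
    ((k : ℝ) + 2) * (k + 1) * s ^ k * (1 - s) ^ 2 * (1 + s) ≤
      2 * (1 - s ^ (k + 2)) * (1 - s ^ (k + 1)) := by
  obtain ⟨r, hr0, rfl⟩ : ∃ r : ℝ, 0 ≤ r ∧ r ^ 2 = s := ⟨√s, Real.sqrt_nonneg s, Real.sq_sqrt h0⟩
  have hr1 : r ≤ 1 := by nlinarith
  have hr : 0 ≤ 1 - r ^ 2 := by linarith
  have hpow : r ^ (2 * k + 4) ≤ 1 := pow_le_one₀ hr0 hr1
  have := mul_le_mul (mul_pow_mul_one_sub_sq_mul_one_add_sq_le k hr0 hr1)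
    (succ_mul_pow_mul_one_sub_sq_le k hr0 hr1) (by positivity) (by linarith)
  calc _ = ((k : ℝ) + 2) * r ^ k * (1 - r ^ 2) * (1 + r ^ 2) *
        (((k : ℝ) + 1) * r ^ k * (1 - r ^ 2)) := by ring
    _ ≤ _ := this
    _ = _ := by ring

lemma succ_mul_pow_mul_one_sub_le (k : ℕ) {s : ℝ} (h0 : 0 ≤ s) (h1 : s ≤ 1) :
    ((k : ℝ) + 1) * s ^ k * (1 - s) ≤ 1 - s ^ (k + 1) := by
  induction k with
  | zero => simp
  | succ k ih =>
    have hs : 0 ≤ 1 - s := by linarith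
    have hk : 0 ≤ ((k : ℝ) + 1) * s ^ k * (1 - s) := by positivity
    have e : s ^ (k + 1 + 1) = s ^ k * s * s := by ring
    rw [e]
    rw [pow_succ] at ih ⊢
    push_cast
    nlinarith [mul_nonneg hk hs]

/-- The inequality `sinh (n * x) * cosh x ≤ n * sinh x * cosh (n * x)`, in the variable
`s = exp (-2 * x)`. -/
lemma one_add_mul_one_sub_pow_le (n : ℕ) (hn : 1 ≤ n) {s : ℝ} (h0 : 0 ≤ s) (h1 : s ≤ 1) :
    (1 + s) * (1 - s ^ n) ≤ n * (1 - s) * (1 + s ^ n) := by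
  induction n, hn using Nat.le_induction with
  | base => norm_num; linarith
  | succ n hn ih =>
    have := mul_le_mul_of_nonneg_right (succ_mul_pow_mul_one_sub_le n h0 h1) (sub_nonneg.2 h1)
    rw [pow_succ] at this ⊢
    push_cast
    linarith

lemma sq_sub_pow_mul_pos (k : ℕ) {s : ℝ} (h0 : 0 ≤ s) (h1 : s < 1) :
    0 < (1 - s ^ (k + 2)) ^ 2 - ((k : ℝ) + 2) ^ 2 * s ^ (k + 1) * (1 - s) ^ 2 := by
  obtain ⟨r, hr0, rfl⟩ : ∃ r : ℝ, 0 ≤ r ∧ r ^ 2 = s := ⟨√s, Real.sqrt_nonneg s, Real.sq_sqrt h0⟩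
  have hr1 : r < 1 := by nlinarith
  have hr : 0 ≤ 1 - r ^ 2 := by linarith
  have := pow_lt_pow_left₀ (succ_mul_pow_mul_one_sub_sq_lt k hr0 hr1) (by positivity) two_ne_zero
  have e : (1 - (r ^ 2) ^ (k + 2)) ^ 2 - ((k : ℝ) + 2) ^ 2 * (r ^ 2) ^ (k + 1) * (1 - r ^ 2) ^ 2
    = (1 - r ^ (2 * k + 4)) ^ 2 - (((k : ℝ) + 2) * r ^ (k + 1) * (1 - r ^ 2)) ^ 2 := by ring
  rw [e]
  linarith

lemma one_sub_pow_sub_pos (k : ℕ) {s : ℝ} (h0 : 0 ≤ s) (h1 : s < 1) :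
    0 < 1 - ((k : ℝ) + 2) * s ^ (k + 1) + ((k : ℝ) + 2) * s ^ (k + 3) - s ^ (2 * k + 4) := by
  have := succ_mul_pow_mul_one_sub_sq_lt k h0 h1
  have e : s ^ (k + 3) = s ^ (k + 1) * s ^ 2 := by ring
  rw [e]
  linarith

/-- The key inequality in the variable `s = t⁻¹`. -/
lemma pow_le_mul_pow_of_lt_one (k : ℕ) {s : ℝ} (h0 : 0 ≤ s) (h1 : s < 1) :
    (1 - ((k : ℝ) + 2) * s ^ (k + 1) + ((k : ℝ) + 2) * s ^ (k + 3) - s ^ (2 * k + 4)) ^ (k + 2) ≤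
      ((1 - s ^ (k + 2)) ^ 2 - ((k : ℝ) + 2) ^ 2 * s ^ (k + 1) * (1 - s) ^ 2) *
        (1 - s ^ (k + 2)) ^ (2 * k + 2) := by
  set A : ℝ → ℝ := fun s => 1 - s ^ (k + 2) with hA
  set B : ℝ → ℝ := fun s =>
    1 - ((k : ℝ) + 2) * s ^ (k + 1) + ((k : ℝ) + 2) * s ^ (k + 3) - s ^ (2 * k + 4) with hB
  set P : ℝ → ℝ := fun s =>
    (1 - s ^ (k + 2)) ^ 2 - ((k : ℝ) + 2) ^ 2 * s ^ (k + 1) * (1 - s) ^ 2 with hP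
  have hApos : ∀ x ∈ Set.Ico (0 : ℝ) 1, 0 < A x := fun x hx =>
    sub_pos.2 (pow_lt_one₀ hx.1 hx.2 (by simp))
  have hBpos : ∀ x ∈ Set.Ico (0 : ℝ) 1, 0 < B x := fun x hx => one_sub_pow_sub_pos k hx.1 hx.2
  have hPpos : ∀ x ∈ Set.Ico (0 : ℝ) 1, 0 < P x := fun x hx => sq_sub_pow_mul_pos k hx.1 hx.2
  set A' : ℝ → ℝ := fun x => -((k + 2) * x ^ (k + 1)) with hA'
  set B' : ℝ → ℝ := fun x => -((k + 2) * ((k + 1) * x ^ k)) + (k + 2) * ((k + 3) * x ^ (k + 2)) -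
    (2 * k + 4) * x ^ (2 * k + 3) with hB'
  set P' : ℝ → ℝ := fun x => 2 * A x * A' x -
    (k + 2) ^ 2 * ((k + 1) * x ^ k * (1 - x) ^ 2 - x ^ (k + 1) * (2 * (1 - x))) with hP'
  have pow_deriv : ∀ (m : ℕ) (x : ℝ), HasDerivAt (fun y : ℝ => y ^ (m + 1)) ((m + 1) * x ^ m) x :=
    fun m x => by simpa using hasDerivAt_pow (m + 1) x
  have dA : ∀ x, HasDerivAt A (A' x) x := fun x => by
    refine ((pow_deriv (k + 1) x).const_sub 1).congr_deriv ?_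
    simp only [hA']; push_cast; ring
  have dB : ∀ x, HasDerivAt B (B' x) x := fun x => by
    refine (((((pow_deriv k x).const_mul ((k : ℝ) + 2)).const_sub 1).add
      ((pow_deriv (k + 2) x).const_mul ((k : ℝ) + 2))).sub (pow_deriv (2 * k + 3) x)).congr_deriv ?_
    simp only [hB']; push_cast; ring
  have dP : ∀ x, HasDerivAt P (P' x) x := fun x => by
    refine (((dA x).pow 2).sub (((pow_deriv k x).const_mul (((k : ℝ) + 2) ^ 2)).mul
      (((hasDerivAt_id x).const_sub 1).pow 2))).congr_deriv ?_
    simp only [hP', id, Pi.pow_apply]; push_cast; ring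
  let h : ℝ → ℝ := fun x =>
    Real.log (P x) - (k + 2) * Real.log (B x) + (2 * k + 2) * Real.log (A x)
  have dh : ∀ x ∈ Set.Ico (0 : ℝ) 1, HasDerivAt h
      (P' x / P x - (k + 2) * (B' x / B x) + (2 * k + 2) * (A' x / A x)) x := fun x hx =>
    (((dP x).log (hPpos x hx).ne').sub (((dB x).log (hBpos x hx).ne').const_mul _)).add
      (((dA x).log (hApos x hx).ne').const_mul _)
  have key : ∀ x, P' x * B x * A x - (k + 2) * B' x * P x * A x + (2 * k + 2) * A' x * P x * B x =
      (k + 2) ^ 2 * x ^ (k + 1) * ((k + 2) * (1 - x) * (1 + x ^ (k + 2)) -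
        (1 + x) * (1 - x ^ (k + 2))) * (2 * (1 - x ^ (k + 2)) * (1 - x ^ (k + 1)) -
          ((k : ℝ) + 2) * (k + 1) * x ^ k * (1 - x) ^ 2 * (1 + x)) := fun x => by
    simp only [hA, hB, hP, hA', hB', hP']
    ring
  have hmono : MonotoneOn h (Set.Ico 0 1) := by
    refine monotoneOn_of_hasDerivWithinAt_nonneg (convex_Ico 0 1)
      (fun x hx => (dh x hx).continuousAt.continuousWithinAt)
      (fun x hx => (dh x (interior_subset hx)).hasDerivWithinAt) fun x hx => ?_
    have hx := interior_subset hx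
    have a := hApos x hx
    have b := hBpos x hx
    have p := hPpos x hx
    have e : P' x / P x - (k + 2) * (B' x / B x) + (2 * k + 2) * (A' x / A x) =
        (P' x * B x * A x - (k + 2) * B' x * P x * A x + (2 * k + 2) * A' x * P x * B x) /
          (P x * B x * A x) := by
      field_simp
    rw [e, key]
    have d₁ := one_add_mul_one_sub_pow_le (k + 2) (by omega) hx.1 hx.2.le
    push_cast at d₁
    have d₂ := mul_pow_mul_one_sub_sq_mul_one_add_le k hx.1 hx.2.le
    have x0 : 0 ≤ x := hx.1
    exact div_nonneg (mul_nonneg (mul_nonneg (by positivity) (sub_nonneg.2 d₁))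
      (sub_nonneg.2 d₂)) (by positivity)
  have hs : s ∈ Set.Ico (0 : ℝ) 1 := ⟨h0, h1⟩
  have hle := hmono ⟨le_rfl, one_pos⟩ hs h0
  have h_zero : h 0 = 0 := by simp [h, hA, hB, hP]
  rw [h_zero] at hle
  have a := hApos s hs
  have b := hBpos s hs
  have p := hPpos s hs
  change B s ^ (k + 2) ≤ P s * A s ^ (2 * k + 2)
  rw [← Real.log_le_log_iff (by positivity) (by positivity),
    Real.log_mul p.ne' (by positivity), Real.log_pow, Real.log_pow]
  push_cast
  simp only [h] at hle
  linarith

theorem key_inequality (n : ℕ) (hn : 3 ≤ n) (t : ℝ) (ht : 1 < t) :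
    ((t ^ n - 1) ^ (2 * n) -
        (n : ℝ) ^ 2 * t ^ (n - 1) * (t - 1) ^ 2 * (t ^ n - 1) ^ (2 * n - 2)) /
      ((t ^ (2 * n) - (n : ℝ) * t ^ (n + 1) + (n : ℝ) * t ^ (n - 1) - 1) ^ n) ≥ 1 := by
  obtain ⟨k, rfl⟩ : ∃ k, n = k + 2 := ⟨n - 2, by omega⟩
  obtain ⟨s, rfl⟩ : ∃ s : ℝ, t = s⁻¹ := ⟨t⁻¹, (inv_inv t).symm⟩
  have hs0 : 0 < s := inv_pos.1 (one_pos.trans ht)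
  have hs1 : s < 1 := (one_lt_inv₀ hs0).1 ht
  have hB : (s⁻¹ ^ (2 * (k + 2)) - ((k + 2 : ℕ) : ℝ) * s⁻¹ ^ (k + 2 + 1) +
      ((k + 2 : ℕ) : ℝ) * s⁻¹ ^ (k + 2 - 1) - 1) =
      (1 - ((k : ℝ) + 2) * s ^ (k + 1) + ((k : ℝ) + 2) * s ^ (k + 3) - s ^ (2 * k + 4)) /
        s ^ (2 * k + 4) := by
    rw [show k + 2 - 1 = k + 1 by omega]
    push_cast
    simp only [inv_pow]
    field_simp
    ring
  have hA : s⁻¹ ^ (k + 2) - 1 = (1 - s ^ (k + 2)) / s ^ (k + 2) := by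
    rw [inv_pow]
    field_simp
  have hP : (s⁻¹ ^ (k + 2) - 1) ^ 2 - ((k + 2 : ℕ) : ℝ) ^ 2 * s⁻¹ ^ (k + 1) * (s⁻¹ - 1) ^ 2 =
      ((1 - s ^ (k + 2)) ^ 2 - ((k : ℝ) + 2) ^ 2 * s ^ (k + 1) * (1 - s) ^ 2) /
        s ^ (2 * k + 4) := by
    push_cast
    simp only [inv_pow]
    field_simp
    ring
  have hF : (s⁻¹ ^ (k + 2) - 1) ^ (2 * (k + 2)) - ((k + 2 : ℕ) : ℝ) ^ 2 * s⁻¹ ^ (k + 2 - 1) *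
      (s⁻¹ - 1) ^ 2 * (s⁻¹ ^ (k + 2) - 1) ^ (2 * (k + 2) - 2) =
      ((1 - s ^ (k + 2)) ^ 2 - ((k : ℝ) + 2) ^ 2 * s ^ (k + 1) * (1 - s) ^ 2) *
        (1 - s ^ (k + 2)) ^ (2 * k + 2) / (s ^ (2 * k + 4)) ^ (k + 2) := by
    rw [show k + 2 - 1 = k + 1 by omega, show 2 * (k + 2) - 2 = 2 * k + 2 by omega,
      show 2 * (k + 2) = 2 + (2 * k + 2) by omega, pow_add _ 2, ← sub_mul, hP, hA, div_pow,
      div_mul_div_comm]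
    congr 1
    ring
  have b := one_sub_pow_sub_pos k hs0.le hs1
  rw [ge_iff_le, hF, hB, div_pow, div_div_div_cancel_right₀ (by positivity),
    one_le_div (by positivity)]
  exact pow_le_mul_pow_of_lt_one k hs0.le hs1
end

section
/- Let n ≥ 3 be an integer and let t ≥ 1 be a real number. Then (2n−2)·t^(3n) + (2n^3 − 2n^2 − 2n + 2)·t^(2n+1) + (n^3 − n)·t^(2n−2) + (2n^3 − 2n^2 − 4)·t^(n+1) + (2n^2 − 4n − 6)·t^n + (n^3 − 2n^2 + n)·t^(n−2) + (2n+2)·t ≥ (2n−2) + (2n^3 − 2n^2 − 2n + 2)·t^(n−1) + (n^3 − n)·t^(n+2) + (2n^3 − 2n^2 − 4)·t^(2n−1) + (2n^2 − 4n − 6)·t^(2n) + (n^3 − 2n^2 + n)·t^(2n+2) + (2n+2)·t^(3n−1). -/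
open Real in
/-- A solution of the differential inequality `a ^ 2 * f ≤ D²f` on `[0, ∞)` with `f 0 = 0` and nonnegative
initial slope is nonnegative on `[0, ∞)`. -/
theorem nonneg_of_second_deriv_sub_sq_mul_nonneg {f f' f'' : ℝ → ℝ} (a : ℝ)
    (hf : ∀ x, HasDerivAt f (f' x) x) (hf' : ∀ x, HasDerivAt f' (f'' x) x)
    (h0 : f 0 = 0) (h0' : 0 ≤ f' 0) (h : ∀ x, 0 ≤ x → 0 ≤ f'' x - a ^ 2 * f x)
    {x : ℝ} (hx : 0 ≤ x) : 0 ≤ f x := by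
  have nonneg_of_deriv_add_mul_nonneg : ∀ (b : ℝ) {g g' : ℝ → ℝ}, (∀ y, HasDerivAt g (g' y) y) → 0 ≤ g 0 →
      (∀ y, 0 ≤ y → 0 ≤ g' y + b * g y) → ∀ y, 0 ≤ y → 0 ≤ g y := by
    intro b g g' hg hg0 hgb y hy
    have hd : ∀ z, HasDerivAt (fun z ↦ exp (b * z) * g z) (exp (b * z) * (g' z + b * g z)) z := by
      intro z
      refine ((((hasDerivAt_id' z).const_mul b).exp).mul (hg z)).congr_deriv ?_
      ring
    have hmono : MonotoneOn (fun z ↦ exp (b * z) * g z) (Set.Ici 0) := by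
      refine monotoneOn_of_deriv_nonneg (convex_Ici 0)
        (fun z _ ↦ (hd z).continuousAt.continuousWithinAt)
        (fun z _ ↦ (hd z).differentiableAt.differentiableWithinAt) fun z hz ↦ ?_
      rw [(hd z).deriv]
      exact mul_nonneg (exp_pos _).le (hgb z (interior_subset hz))
    have := hmono Set.self_mem_Ici hy hy
    simp only [mul_zero, exp_zero, one_mul] at this
    exact nonneg_of_mul_nonneg_right (hg0.trans this) (exp_pos _)
  refine nonneg_of_deriv_add_mul_nonneg a hf h0.ge (fun y hy ↦ ?_) x hx
  refine nonneg_of_deriv_add_mul_nonneg (-a) (g := fun z ↦ f' z + a * f z)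
    (fun z ↦ (hf' z).add ((hf z).const_mul a)) (by simpa [h0] using h0') (fun z hz ↦ ?_) y hy
  linarith [h z hz]

open Real in
theorem sum_mul_sinh_nonneg {ι : Type*} (s : Finset ι) (c m : ι → ℝ) (a : ℝ)
    (h0 : 0 ≤ ∑ i ∈ s, c i * m i)
    (h : ∀ x, 0 ≤ x → 0 ≤ ∑ i ∈ s, c i * (m i ^ 2 - a ^ 2) * sinh (m i * x))
    {x : ℝ} (hx : 0 ≤ x) : 0 ≤ ∑ i ∈ s, c i * sinh (m i * x) := by
  have hmul : ∀ i y, HasDerivAt (fun z ↦ m i * z) (m i) y := fun i y ↦ by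
    simpa using (hasDerivAt_id y).const_mul (m i)
  refine nonneg_of_second_deriv_sub_sq_mul_nonneg
    (f := fun y ↦ ∑ i ∈ s, c i * sinh (m i * y))
    (f' := fun y ↦ ∑ i ∈ s, c i * (cosh (m i * y) * m i))
    (f'' := fun y ↦ ∑ i ∈ s, c i * (sinh (m i * y) * m i * m i)) a
    (fun y ↦ HasDerivAt.fun_sum fun i _ ↦ ((hmul i y).sinh).const_mul _)
    (fun y ↦ HasDerivAt.fun_sum fun i _ ↦ (((hmul i y).cosh).mul_const _).const_mul _)
    (by simp) (by simpa using h0) (fun y hy ↦ ?_) hx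
  convert h y hy using 1
  rw [Finset.mul_sum, ← Finset.sum_sub_distrib]
  exact Finset.sum_congr rfl fun i _ ↦ by ring

open Real in
theorem exp_two_mul_pow_sub_pow (x : ℝ) {j k N : ℕ} {m : ℝ} (hN : j + k = N)
    (hm : (j : ℝ) - k = m) :
    exp (2 * x) ^ j - exp (2 * x) ^ k = 2 * exp (N * x) * sinh (m * x) := by
  subst hN hm
  rw [← exp_nat_mul, ← exp_nat_mul, sinh_eq]
  have hj : (j : ℝ) * (2 * x) = ((j + k : ℕ) : ℝ) * x + (j - k) * x := by push_cast; ring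
  have hk : (k : ℝ) * (2 * x) = ((j + k : ℕ) : ℝ) * x + -((j - k) * x) := by push_cast; ring
  rw [hj, hk, exp_add, exp_add]
  ring

open Real in
theorem seven_term_sinh_sum_nonneg {n x : ℝ} (hn : 3 ≤ n) (hx : 0 ≤ x) :
    0 ≤ (2 * n - 2) * sinh (3 * n * x) + 2 * (n - 1) ^ 2 * (n + 1) * sinh ((n + 2) * x) +
      (n ^ 3 - n) * sinh ((n - 4) * x) - (2 * n ^ 3 - 2 * n ^ 2 - 4) * sinh ((n - 2) * x) -
      (2 * n ^ 2 - 4 * n - 6) * sinh (n * x) - n * (n - 1) ^ 2 * sinh ((n + 4) * x) -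
      (2 * n + 2) * sinh ((3 * n - 2) * x) := by
  let c : Fin 7 → ℝ := ![2 * n - 2, 2 * (n - 1) ^ 2 * (n + 1), n ^ 3 - n,
    -(2 * n ^ 3 - 2 * n ^ 2 - 4), -(2 * n ^ 2 - 4 * n - 6), -(n * (n - 1) ^ 2), -(2 * n + 2)]
  let m : Fin 7 → ℝ := ![3 * n, n + 2, n - 4, n - 2, n, n + 4, 3 * n - 2]
  suffices 0 ≤ ∑ i, c i * sinh (m i * x) by
    simp [c, m, Fin.sum_univ_succ] at this
    linarith
  refine sum_mul_sinh_nonneg _ _ _ (n - 4) (le_of_eq ?_) (fun x hx ↦ ?_) hx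
  · simp [c, m, Fin.sum_univ_succ]
    ring
  refine sum_mul_sinh_nonneg _ _ _ n (le_of_eq ?_) (fun x hx ↦ ?_) hx
  · simp [c, m, Fin.sum_univ_succ]
    ring
  refine sum_mul_sinh_nonneg _ _ _ (3 * n - 2) (le_of_eq ?_) (fun x hx ↦ ?_) hx
  · simp [c, m, Fin.sum_univ_succ]
    ring
  refine sum_mul_sinh_nonneg _ _ _ (n + 2) ?_ (fun x hx ↦ ?_) hx
  · have : 0 ≤ 8960 * n ^ 2 * (n - 2) * (n ^ 2 - 1) ^ 2 :=
      mul_nonneg (mul_nonneg (by positivity) (by linarith)) (by positivity)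
    refine this.trans_eq ?_
    simp [c, m, Fin.sum_univ_succ]
    ring
  obtain ⟨d, hd, rfl⟩ : ∃ d, 0 ≤ d ∧ n = d + 3 := ⟨n - 3, by linarith, by ring⟩
  refine Finset.sum_nonneg fun i _ ↦ ?_
  by_cases hi : i = 2
  · simp [hi, c, m]
  refine mul_nonneg ?_ (sinh_nonneg_iff.2 (mul_nonneg ?_ hx))
  · fin_cases i
    all_goals simp [c, m]
    all_goals rw [← sub_nonneg]
    all_goals ring_nf
    all_goals positivity
  · fin_cases i
    all_goals simp [m] at hi ⊢
    all_goals linarith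

theorem poly_p1_nonneg (n : ℕ) (hn : 3 ≤ n) (t : ℝ) (ht : 1 ≤ t) :
    (2 * (n : ℝ) - 2) * t ^ (3 * n) +
        (2 * (n : ℝ) ^ 3 - 2 * (n : ℝ) ^ 2 - 2 * (n : ℝ) + 2) * t ^ (2 * n + 1) +
        ((n : ℝ) ^ 3 - (n : ℝ)) * t ^ (2 * n - 2) +
        (2 * (n : ℝ) ^ 3 - 2 * (n : ℝ) ^ 2 - 4) * t ^ (n + 1) +
        (2 * (n : ℝ) ^ 2 - 4 * (n : ℝ) - 6) * t ^ n +
        ((n : ℝ) ^ 3 - 2 * (n : ℝ) ^ 2 + (n : ℝ)) * t ^ (n - 2) +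
        (2 * (n : ℝ) + 2) * t ≥
      (2 * (n : ℝ) - 2) +
        (2 * (n : ℝ) ^ 3 - 2 * (n : ℝ) ^ 2 - 2 * (n : ℝ) + 2) * t ^ (n - 1) +
        ((n : ℝ) ^ 3 - (n : ℝ)) * t ^ (n + 2) +
        (2 * (n : ℝ) ^ 3 - 2 * (n : ℝ) ^ 2 - 4) * t ^ (2 * n - 1) +
        (2 * (n : ℝ) ^ 2 - 4 * (n : ℝ) - 6) * t ^ (2 * n) +
        ((n : ℝ) ^ 3 - 2 * (n : ℝ) ^ 2 + (n : ℝ)) * t ^ (2 * n + 2) +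
        (2 * (n : ℝ) + 2) * t ^ (3 * n - 1) := by
  obtain ⟨x, hx, rfl⟩ : ∃ x, 0 ≤ x ∧ t = Real.exp (2 * x) :=
    ⟨Real.log t / 2, by have := Real.log_nonneg ht; positivity,
      by rw [mul_div_cancel₀ _ two_ne_zero, Real.exp_log (by linarith)]⟩
  have hn' : (3 : ℝ) ≤ n := by exact_mod_cast hn
  have h := mul_nonneg (by positivity : 0 ≤ 2 * Real.exp ((3 * n : ℕ) * x))
    (seven_term_sinh_sum_nonneg hn' hx)
  have e₁ := exp_two_mul_pow_sub_pow x (j := 3 * n) (k := 0) (N := 3 * n) (m := 3 * n)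
    (by lia) (by push_cast; ring)
  have e₂ := exp_two_mul_pow_sub_pow x (j := 2 * n + 1) (k := n - 1) (N := 3 * n) (m := n + 2)
    (by lia) (by rw [Nat.cast_sub (by lia)]; push_cast; ring)
  have e₃ := exp_two_mul_pow_sub_pow x (j := 2 * n - 2) (k := n + 2) (N := 3 * n) (m := n - 4)
    (by lia) (by rw [Nat.cast_sub (by lia)]; push_cast; ring)
  have e₄ := exp_two_mul_pow_sub_pow x (j := 2 * n - 1) (k := n + 1) (N := 3 * n) (m := n - 2)
    (by lia) (by rw [Nat.cast_sub (by lia)]; push_cast; ring)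
  have e₅ := exp_two_mul_pow_sub_pow x (j := 2 * n) (k := n) (N := 3 * n) (m := n)
    (by lia) (by push_cast; ring)
  have e₆ := exp_two_mul_pow_sub_pow x (j := 2 * n + 2) (k := n - 2) (N := 3 * n) (m := n + 4)
    (by lia) (by rw [Nat.cast_sub (by lia)]; push_cast; ring)
  have e₇ := exp_two_mul_pow_sub_pow x (j := 3 * n - 1) (k := 1) (N := 3 * n) (m := 3 * n - 2)
    (by lia) (by rw [Nat.cast_sub (by lia)]; push_cast; ring)
  rw [pow_zero] at e₁
  rw [pow_one] at e₇
  rw [ge_iff_le, ← sub_nonneg]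
  refine h.trans_eq ?_
  linear_combination -(2 * (n : ℝ) - 2) * e₁ - 2 * ((n : ℝ) - 1) ^ 2 * (n + 1) * e₂ -
    ((n : ℝ) ^ 3 - n) * e₃ + (2 * (n : ℝ) ^ 3 - 2 * (n : ℝ) ^ 2 - 4) * e₄ +
    (2 * (n : ℝ) ^ 2 - 4 * n - 6) * e₅ + n * ((n : ℝ) - 1) ^ 2 * e₆ + (2 * (n : ℝ) + 2) * e₇
end
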